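/- Let k = 3 and let G=(V,E) be the complete graph on n vertices. Let L be a sequence of moves for max-3-cut that is valid from some initial configuration τ_0 : V → [3]. Then rank(P_{L,τ_0}) ≥ (1/6)·Σ_{v∈C(L)} (b_L(v) − 3). -/

import Mathlib

open Finset MeasureTheory ProbabilityTheory Filter
open scoped Classical

/-- Edges of the complete graph on `n` vertices: ordered pairs `(a,b)` with `a < b`. -/
abbrev mcEdge (n : ℕ) := {e : Fin n × Fin n // e.1 < e.2}

/-- A move `(v,p,q)` for max-`k`-cut: vertex `v` moves from part `p` to part `q`. -/
abbrev KMove (n k : ℕ) := Fin n × Fin k × Fin k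

/-- The inner product `⟨σ(i),σ(j)⟩` of the unit simplex vectors: `1` if `i = j`
and `−1/(k−1)` otherwise. -/
noncomputable def sigmaDot (k : ℕ) (i j : Fin k) : ℝ :=
  if i = j then 1 else -(1 / ((k : ℝ) - 1))

/-- Performing the move `m = (v,p,q)`: vertex `v` is placed in part `q`. -/
def kStep {n k : ℕ} (τ : Fin n → Fin k) (m : KMove n k) : Fin n → Fin k :=
  Function.update τ m.1 m.2.2

/-- The configuration reached from `τ` after performing all moves of `L`. -/
def kRun {n k : ℕ} (τ : Fin n → Fin k) : List (KMove n k) → (Fin n → Fin k)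
  | [] => τ
  | m :: L => kRun (kStep τ m) L

/-- `L` is a valid sequence of moves from `τ`: each move `(v,p,q)` has `p ≠ q` and is
applied when `τ(v) = p`. -/
def kValid {n k : ℕ} : (Fin n → Fin k) → List (KMove n k) → Prop
  | _, [] => True
  | τ, m :: L => τ m.1 = m.2.1 ∧ m.2.1 ≠ m.2.2 ∧ kValid (kStep τ m) L

/-- The configuration `τ_t` after the first `t` moves of `L`. -/
def kConfAt {n k : ℕ} (τ0 : Fin n → Fin k) (L : List (KMove n k)) (t : ℕ) : Fin n → Fin k :=
  kRun τ0 (L.take t)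

/-- The entry `M_{L,τ0}[{a,b},t]` of the matrix `M` for max-`k`-cut. -/
noncomputable def kM {n k : ℕ} (L : List (KMove n k)) (τ0 : Fin n → Fin k) (a b : Fin n)
    (t : Fin L.length) : ℚ :=
  if (a = (L.get t).1 ∧ (L.get t).2.2 = kConfAt τ0 L (t + 1) b) ∨
     (b = (L.get t).1 ∧ (L.get t).2.2 = kConfAt τ0 L (t + 1) a) then 1
  else if (a = (L.get t).1 ∧ (L.get t).2.1 = kConfAt τ0 L (t + 1) b) ∨
     (b = (L.get t).1 ∧ (L.get t).2.1 = kConfAt τ0 L (t + 1) a) then -1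
  else 0

/-- The set of time steps `T` is a circuit over the vertex `v` in `L`: all moves at times of
`T` are moves of `v`, consecutive moves (in increasing order of time) match up
(`q_{t_i} = p_{t_{i+1}}`), and the last move returns to the starting part
(`q_{t_w} = p_{t_1}`). -/
def IsCircuit {n k : ℕ} (L : List (KMove n k)) (v : Fin n)
    (T : Finset (Fin L.length)) : Prop :=
  T.Nonempty ∧ (∀ t ∈ T, (L.get t).1 = v) ∧
  List.Chain' (fun a b => (L.get a).2.2 = (L.get b).2.1) (T.sort (· ≤ ·)) ∧
  ∀ h : T.Nonempty, (L.get (T.max' h)).2.2 = (L.get (T.min' h)).2.1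

/-- A cycle is an inclusion-wise minimal circuit. -/
def IsCycle {n k : ℕ} (L : List (KMove n k)) (v : Fin n)
    (T : Finset (Fin L.length)) : Prop :=
  IsCircuit L v T ∧ ∀ T' ⊂ T, ¬ IsCircuit L v T'

/-- The set `Γ(L)` of cycles of `L`, as a type: a vertex together with the set of time
steps of a cycle over it. -/
abbrev KCycle {n k : ℕ} (L : List (KMove n k)) :=
  {c : Fin n × Finset (Fin L.length) // IsCycle L c.1 c.2}

/-- The entry `P_{L,τ0}[{a,b},C] = ∑_{t ∈ T(C)} M_{L,τ0}[{a,b},t]`. -/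
noncomputable def kPval {n k : ℕ} (L : List (KMove n k)) (τ0 : Fin n → Fin k)
    (a b : Fin n) (T : Finset (Fin L.length)) : ℚ :=
  ∑ t ∈ T, kM L τ0 a b t

/-- The set `S(L)` of vertices appearing in `L`. -/
def kS {n k : ℕ} (L : List (KMove n k)) : Finset (Fin n) := (L.map Prod.fst).toFinset

/-- The set `C(L)` of cyclic vertices of `L`: vertices over which some cycle of `L` lies. -/
noncomputable def cyclicSet {n k : ℕ} (L : List (KMove n k)) : Finset (Fin n) :=
  Finset.univ.filter (fun v => ∃ T, IsCycle L v T)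

/-- The set `A(L)` of acyclic vertices of `L`: vertices of `L` that are not cyclic. -/
noncomputable def acyclicSet {n k : ℕ} (L : List (KMove n k)) : Finset (Fin n) :=
  kS L \ cyclicSet L

/-- Position `t` of `L` holds a move of a cyclic vertex of `L`. -/
def cycPos {n k : ℕ} (L : List (KMove n k)) (t : ℕ) : Prop :=
  ∃ m, L[t]? = some m ∧ m.1 ∈ cyclicSet L

/-- The interval of positions `[i,j]` is a cyclic block of `L`: a maximal block of `L`
consisting only of cyclic vertices of `L`. -/
def IsCycBlock {n k : ℕ} (L : List (KMove n k)) (i j : ℕ) : Prop :=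
  i ≤ j ∧ j < L.length ∧ (∀ t, i ≤ t → t ≤ j → cycPos L t) ∧
  (i = 0 ∨ ¬ cycPos L (i - 1)) ∧ ¬ cycPos L (j + 1)

/-- `b_L(v)`: the number of cyclic blocks of `L` in which `v` occurs. -/
noncomputable def bL {n k : ℕ} (L : List (KMove n k)) (v : Fin n) : ℕ :=
  ((Finset.range L.length ×ˢ Finset.range L.length).filter
    (fun p => IsCycBlock L p.1 p.2 ∧
      ∃ t, p.1 ≤ t ∧ t ≤ p.2 ∧ ∃ m, L[t]? = some m ∧ m.1 = v)).card

/-- The matrix `P_{L,τ0}` for the complete graph: rows indexed by edges (pairs `a < b`),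
columns indexed by the cycles of `L`. -/
noncomputable def kP {n k : ℕ} (L : List (KMove n k)) (τ0 : Fin n → Fin k) :
    Matrix (mcEdge n) (KCycle L) ℚ :=
  fun e c => kPval L τ0 e.1.1 e.1.2 c.1.2

section Moves

variable {n k : ℕ}

/-- The contribution of a move from part `p` to part `q` seen from a vertex in part `c`. -/
def moveSign (p q c : Fin k) : ℚ :=
  if q = c then 1 else if p = c then -1 else 0

theorem kConfAt_succ_of_valid (L : List (KMove n k)) (τ : Fin n → Fin k) (h : kValid τ L)
    (t : Fin L.length) :
    kConfAt τ L t (L.get t).1 = (L.get t).2.1 ∧ (L.get t).2.1 ≠ (L.get t).2.2 ∧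
      kConfAt τ L (t + 1) = Function.update (kConfAt τ L t) (L.get t).1 (L.get t).2.2 := by
  induction L generalizing τ with
  | nil => exact t.elim0
  | cons m L ih =>
    obtain ⟨h1, h2, h3⟩ := h
    refine Fin.cases ?_ (fun t => ?_) t
    · exact ⟨h1, h2, rfl⟩
    · exact ih (kStep τ m) h3 t

theorem kM_eq_moveSign {L : List (KMove n k)} {τ : Fin n → Fin k} {a v : Fin n} (hav : a ≠ v)
    {t : Fin L.length} (ht : (L.get t).1 = v) :
    kM L τ a v t = moveSign (L.get t).2.1 (L.get t).2.2 (kConfAt τ L (t + 1) a) := by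
  subst ht
  simp only [kM, moveSign, hav, false_and, true_and, false_or]

theorem kM_eq_zero {L : List (KMove n k)} {τ : Fin n → Fin k} {a b : Fin n}
    {t : Fin L.length} (ha : a ≠ (L.get t).1) (hb : b ≠ (L.get t).1) :
    kM L τ a b t = 0 := by
  simp only [kM, ha, hb, false_and, or_self, if_false]

theorem kPval_comm (L : List (KMove n k)) (τ : Fin n → Fin k) (a b : Fin n)
    (T : Finset (Fin L.length)) : kPval L τ a b T = kPval L τ b a T := by
  unfold kPval kM
  refine Finset.sum_congr rfl fun t _ => ?_
  simp only [or_comm]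

theorem sum_chain_telescope {α β : Type*} (s d : α → β) (f : β → ℚ) (l : List α) (hl : l ≠ [])
    (h : List.IsChain (fun a b => d a = s b) l) :
    (l.map fun a => f (d a) - f (s a)).sum = f (d (l.getLast hl)) - f (s (l.head hl)) := by
  induction l with
  | nil => exact absurd rfl hl
  | cons a l ih =>
    cases l with
    | nil => simp
    | cons b l =>
      rw [List.isChain_cons_cons] at h
      have := ih (by simp) h.2
      rw [List.map_cons, List.sum_cons, this, h.1]
      simp

theorem IsCircuit.sum_eq_zero {L : List (KMove n k)} {v : Fin n} {T : Finset (Fin L.length)}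
    (h : IsCircuit L v T) (f : Fin k → ℚ) :
    ∑ t ∈ T, (f (L.get t).2.2 - f (L.get t).2.1) = 0 := by
  obtain ⟨hne, -, hc, hm⟩ := h
  have hl : T.sort (· ≤ ·) ≠ [] := by
    intro h0
    have := Finset.length_sort (s := T) (· ≤ ·)
    rw [h0] at this
    exact hne.card_pos.ne this
  have := sum_chain_telescope (fun a => (L.get a).2.1) (fun a => (L.get a).2.2) f _ hl hc
  have hs := (List.sum_toFinset (fun a => f (L.get a).2.2 - f (L.get a).2.1)
    (Finset.sort_nodup T (· ≤ ·)))
  rw [Finset.sort_toFinset] at hs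
  rw [hs, this]
  have e1 : (T.sort (· ≤ ·)).getLast hl = T.max' hne := by
    rw [Finset.max'_eq_sorted_last, List.getLast_eq_getElem]
  have e2 : (T.sort (· ≤ ·)).head hl = T.min' hne := by
    rw [Finset.min'_eq_sorted_zero, List.head_eq_getElem]
  rw [e1, e2, hm hne, sub_self]

theorem isCircuit_pair {L : List (KMove n k)} {v : Fin n} {s t : Fin L.length} (hst : s < t)
    (hs : (L.get s).1 = v) (ht : (L.get t).1 = v) (h1 : (L.get s).2.2 = (L.get t).2.1)
    (h2 : (L.get t).2.2 = (L.get s).2.1) : IsCircuit L v {s, t} := by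
  refine ⟨by simp, by simpa using ⟨hs, ht⟩, ?_, ?_⟩
  · rw [Finset.sort_insert _ (by simp [hst.le]) (by simp [hst.ne]), Finset.sort_singleton]
    exact List.isChain_pair.2 h1
  · intro h
    rw [(Finset.max'_eq_iff _ h t).2 (by simp [hst.le]),
      (Finset.min'_eq_iff _ h s).2 (by simp [hst.le]), h2]

theorem isCircuit_triple {L : List (KMove n k)} {v : Fin n} {s t u : Fin L.length}
    (hst : s < t) (htu : t < u)
    (hs : (L.get s).1 = v) (ht : (L.get t).1 = v) (hu : (L.get u).1 = v)
    (h1 : (L.get s).2.2 = (L.get t).2.1) (h2 : (L.get t).2.2 = (L.get u).2.1)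
    (h3 : (L.get u).2.2 = (L.get s).2.1) : IsCircuit L v {s, t, u} := by
  have hsu := hst.trans htu
  refine ⟨by simp, by simpa using ⟨hs, ht, hu⟩, ?_, ?_⟩
  · rw [Finset.sort_insert _ (by simp [hst.le, hsu.le]) (by simp [hst.ne, hsu.ne]),
      Finset.sort_insert _ (by simp [htu.le]) (by simp [htu.ne]), Finset.sort_singleton]
    exact List.isChain_cons_cons.2 ⟨h1, List.isChain_pair.2 h2⟩
  · intro h
    rw [(Finset.max'_eq_iff _ h u).2 (by simp [htu.le, hsu.le]),
      (Finset.min'_eq_iff _ h s).2 (by simp [hst.le, hsu.le]), h3]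

/-- A circuit with at most three moves is a cycle. -/
theorem IsCircuit.isCycle_of_card_le_three {L : List (KMove n k)} {τ : Fin n → Fin k}
    (hval : kValid τ L) {v : Fin n} {T : Finset (Fin L.length)} (h : IsCircuit L v T)
    (hT : T.card ≤ 3) : IsCycle L v T := by
  have key : ∀ S : Finset (Fin L.length), S.card = 1 →
      ¬ ∀ f : Fin k → ℚ, ∑ t ∈ S, (f (L.get t).2.2 - f (L.get t).2.1) = 0 := by
    intro S hS hz
    obtain ⟨t, rfl⟩ := Finset.card_eq_one.1 hS
    have := hz (fun c => if c = (L.get t).2.1 then 1 else 0)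
    have hne := (kConfAt_succ_of_valid L τ hval t).2.1
    simp only [Finset.sum_singleton, hne.symm, if_false, if_true] at this
    norm_num at this
  refine ⟨h, fun T' hT' h' => ?_⟩
  have hc := Finset.card_lt_card hT'
  have hp := h'.1.card_pos
  have hsd := Finset.card_sdiff_of_subset hT'.1
  rcases (by omega : T'.card = 1 ∨ (T \ T').card = 1) with h1 | h1
  · exact key _ h1 h'.sum_eq_zero
  · refine key _ h1 fun f => ?_
    have := Finset.sum_sdiff hT'.1 (f := fun t => f (L.get t).2.2 - f (L.get t).2.1)
    rw [h'.sum_eq_zero, h.sum_eq_zero] at this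
    simpa using this

/-- If a property of the part of `v` holds at time `i` and fails at time `j`, some move of `v`
in between destroys it. -/
theorem exists_move_of_change {L : List (KMove n k)} {τ : Fin n → Fin k} (hval : kValid τ L)
    (v : Fin n) (P : Fin k → Prop) {i j : ℕ} (hij : i ≤ j) (hj : j ≤ L.length)
    (hPi : P (kConfAt τ L i v)) (hPj : ¬ P (kConfAt τ L j v)) :
    ∃ s : Fin L.length, i ≤ s ∧ (s : ℕ) < j ∧ (L.get s).1 = v ∧ P (L.get s).2.1 ∧
      ¬ P (L.get s).2.2 := by
  induction j, hij using Nat.le_induction with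
  | base => exact absurd hPi hPj
  | succ j hij ih =>
    by_cases hP : P (kConfAt τ L j v)
    · obtain ⟨h1, -, h3⟩ := kConfAt_succ_of_valid L τ hval ⟨j, hj⟩
      simp only at h1 h3
      by_cases hv : (L.get ⟨j, hj⟩).1 = v
      · subst hv
        refine ⟨⟨j, hj⟩, hij, Nat.lt_succ_self j, rfl, h1 ▸ hP, ?_⟩
        rw [h3, Function.update_self] at hPj
        exact hPj
      · rw [h3, Function.update_of_ne (Ne.symm hv)] at hPj
        exact absurd hP hPj
    · obtain ⟨s, h1, h2, h⟩ := ih (by omega) hP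
      exact ⟨s, h1, by omega, h⟩

theorem kConfAt_move_src {L : List (KMove n k)} {τ : Fin n → Fin k} (hval : kValid τ L)
    {v : Fin n} {t : Fin L.length} (ht : (L.get t).1 = v) :
    kConfAt τ L t v = (L.get t).2.1 := by
  subst ht
  exact (kConfAt_succ_of_valid L τ hval t).1

theorem kConfAt_move_dst {L : List (KMove n k)} {τ : Fin n → Fin k} (hval : kValid τ L)
    {v : Fin n} {t : Fin L.length} (ht : (L.get t).1 = v) :
    kConfAt τ L (t + 1) v = (L.get t).2.2 := by
  subst ht
  rw [(kConfAt_succ_of_valid L τ hval t).2.2, Function.update_self]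

end Moves

section ThreeParts

variable {n : ℕ} {L : List (KMove n 3)} {τ : Fin n → Fin 3} {v : Fin n}

theorem exists_cycle_of_return (hval : kValid τ L) {t t' : Fin L.length} (htt : t < t')
    (ht : (L.get t).1 = v) (ht' : (L.get t').1 = v) (h : (L.get t').2.2 = (L.get t).2.1) :
    ∃ T, IsCycle L v T ∧ t ∈ T ∧ ∀ s ∈ T, s ≠ t → t < s := by
  have pair : ∀ s : Fin L.length, t < s → (L.get s).1 = v → (L.get s).2.1 = (L.get t).2.2 →
      (L.get s).2.2 = (L.get t).2.1 → ∃ T, IsCycle L v T ∧ t ∈ T ∧ ∀ s ∈ T, s ≠ t → t < s := by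
    intro s hs hv h1 h2
    refine ⟨{t, s}, (isCircuit_pair hs ht hv h1.symm h2).isCycle_of_card_le_three hval ?_, ?_, ?_⟩
    · exact (Finset.card_le_two).trans (by norm_num)
    · simp
    · simp [hs]
  by_cases h1 : (L.get t').2.1 = (L.get t).2.2
  · exact pair t' htt ht' h1 h
  obtain ⟨s, hs1, hs2, hsv, hs3, hs4⟩ := exists_move_of_change hval v
    (fun c => c = (L.get t).2.2) (i := t + 1) (j := t') htt t'.2.le
    (kConfAt_move_dst hval ht) (by rwa [kConfAt_move_src hval ht'])
  have hts : t < s := hs1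
  have hst : s < t' := hs2
  by_cases h2 : (L.get s).2.2 = (L.get t).2.1
  · exact pair s hts hsv hs3 h2
  have h3 : (L.get s).2.2 = (L.get t').2.1 := by
    have a1 := (kConfAt_succ_of_valid L τ hval t).2.1
    have a2 := (kConfAt_succ_of_valid L τ hval t').2.1
    grind
  refine ⟨{t, s, t'}, (isCircuit_triple hts hst ht hsv ht' hs3.symm h3 h).isCycle_of_card_le_three
    hval Finset.card_le_three, by simp, by simp [hts, htt]⟩

theorem exists_cycle_of_previous_visit (hval : kValid τ L) {t t' : Fin L.length} (htt : t' < t)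
    (ht : (L.get t).1 = v) (ht' : (L.get t').1 = v) (h : (L.get t').2.1 = (L.get t).2.2) :
    ∃ T, IsCycle L v T ∧ t ∈ T ∧ ∀ s ∈ T, s ≠ t → s < t := by
  have pair : ∀ s : Fin L.length, s < t → (L.get s).1 = v → (L.get s).2.1 = (L.get t).2.2 →
      (L.get s).2.2 = (L.get t).2.1 → ∃ T, IsCycle L v T ∧ t ∈ T ∧ ∀ s ∈ T, s ≠ t → s < t := by
    intro s hs hv h1 h2
    refine ⟨{s, t}, (isCircuit_pair hs hv ht h2 h1.symm).isCycle_of_card_le_three hval ?_, ?_, ?_⟩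
    · exact (Finset.card_le_two).trans (by norm_num)
    · simp
    · simp [hs]
  by_cases h1 : (L.get t').2.2 = (L.get t).2.1
  · exact pair t' htt ht' h h1
  obtain ⟨s, hs1, hs2, hsv, hs3, hs4⟩ := exists_move_of_change hval v
    (fun c => c ≠ (L.get t).2.1) (i := t' + 1) (j := t) htt t.2.le
    (by rwa [kConfAt_move_dst hval ht']) (by rw [kConfAt_move_src hval ht]; simp)
  rw [not_not] at hs4
  have hts : t' < s := hs1
  have hst : s < t := hs2
  by_cases h2 : (L.get s).2.1 = (L.get t).2.2
  · exact pair s hst hsv h2 hs4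
  have h3 : (L.get t').2.2 = (L.get s).2.1 := by
    have a1 := (kConfAt_succ_of_valid L τ hval t).2.1
    have a2 := (kConfAt_succ_of_valid L τ hval t').2.1
    grind
  refine ⟨{t', s, t}, (isCircuit_triple hts hst ht' hsv ht h3 hs4 h.symm).isCycle_of_card_le_three
    hval Finset.card_le_three, by simp, by simp [hst, htt]⟩

/-- A vertex that is not cyclic never comes back to a part it left. -/
theorem kConfAt_ne_of_not_cyclic (hval : kValid τ L) {a : Fin n} (ha : a ∉ cyclicSet L)
    {s : Fin L.length} (hs : (L.get s).1 = a) {i j : ℕ} (hi : i ≤ s) (hj : s < j)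
    (hjL : j ≤ L.length) : kConfAt τ L i a ≠ kConfAt τ L j a := by
  intro he
  apply ha
  obtain ⟨t, ht1, ht2, hta, ht3⟩ : ∃ t : Fin L.length, i ≤ t ∧ (t : ℕ) < j ∧ (L.get t).1 = a ∧
      (L.get t).2.1 = kConfAt τ L i a := by
    by_cases h : kConfAt τ L s a = kConfAt τ L i a
    · exact ⟨s, hi, hj, hs, (kConfAt_move_src hval hs).symm.trans h⟩
    · obtain ⟨t, h1, h2, h3, h4, -⟩ := exists_move_of_change hval a
        (fun c => c = kConfAt τ L i a) hi s.2.le rfl h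
      exact ⟨t, h1, by omega, h3, h4⟩
  have hne := (kConfAt_succ_of_valid L τ hval t).2.1
  obtain ⟨u, hu1, hu2, hua, hu3, hu4⟩ := exists_move_of_change hval a
    (fun c => c ≠ kConfAt τ L i a) (i := t + 1) (j := j) ht2 hjL
    (by rw [kConfAt_move_dst hval hta, ← ht3]; exact hne.symm) (by simp [he])
  rw [not_not] at hu4
  obtain ⟨T, hT, -⟩ := exists_cycle_of_return (t := t) (t' := u) hval hu1 hta hua
    (hu4.trans ht3.symm)
  simp only [cyclicSet, Finset.mem_filter, Finset.mem_univ, true_and]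
  exact ⟨T, hT⟩

end ThreeParts

section Entries

variable {n : ℕ} {L : List (KMove n 3)} {τ : Fin n → Fin 3} {v a : Fin n}

theorem moveSign_eq_sub {k : ℕ} {p q : Fin k} (h : p ≠ q) (c : Fin k) :
    moveSign p q c = (if q = c then 1 else 0) - (if p = c then 1 else 0) := by
  unfold moveSign
  grind

theorem moveSign_injective {p q : Fin 3} (h : p ≠ q) {c d : Fin 3}
    (hcd : c ≠ d) : moveSign p q c ≠ moveSign p q d := by
  unfold moveSign
  split_ifs <;> first | omega | norm_num

theorem sum_moveSign_const (hval : kValid τ L) {T : Finset (Fin L.length)}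
    (hT : IsCircuit L v T) (c : Fin 3) :
    ∑ t ∈ T, moveSign (L.get t).2.1 (L.get t).2.2 c = 0 := by
  rw [← hT.sum_eq_zero fun x => if x = c then 1 else 0]
  exact Finset.sum_congr rfl fun t _ => moveSign_eq_sub (kConfAt_succ_of_valid L τ hval t).2.1 c

theorem kPval_eq_sum_moveSign (hav : a ≠ v) {T : Finset (Fin L.length)} (hT : IsCircuit L v T) :
    kPval L τ a v T =
      ∑ t ∈ T, moveSign (L.get t).2.1 (L.get t).2.2 (kConfAt τ L (t + 1) a) :=
  Finset.sum_congr rfl fun t ht => kM_eq_moveSign hav (hT.2.1 t ht)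

theorem kPval_eq_zero_of_const (hval : kValid τ L) (hav : a ≠ v) {T : Finset (Fin L.length)}
    (hT : IsCircuit L v T) {c : Fin 3} (hc : ∀ t ∈ T, kConfAt τ L (t + 1) a = c) :
    kPval L τ a v T = 0 := by
  rw [kPval_eq_sum_moveSign hav hT, ← sum_moveSign_const hval hT c]
  exact Finset.sum_congr rfl fun t ht => by rw [hc t ht]

theorem kPval_ne_zero_of_const_off (hval : kValid τ L) (hav : a ≠ v)
    {T : Finset (Fin L.length)} (hT : IsCircuit L v T) {t₀ : Fin L.length} (ht₀ : t₀ ∈ T)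
    {c : Fin 3} (hc : ∀ t ∈ T, t ≠ t₀ → kConfAt τ L (t + 1) a = c)
    (hne : kConfAt τ L (t₀ + 1) a ≠ c) : kPval L τ a v T ≠ 0 := by
  have h0 := sum_moveSign_const hval hT c
  rw [kPval_eq_sum_moveSign hav hT]
  rw [← Finset.add_sum_erase _ _ ht₀] at h0 ⊢
  rw [Finset.sum_congr rfl fun t ht => by
    rw [hc t (Finset.mem_of_mem_erase ht) (Finset.ne_of_mem_erase ht)]]
  intro h
  exact moveSign_injective (kConfAt_succ_of_valid L τ hval t₀).2.1 hne
    (add_right_cancel (h.trans h0.symm))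

theorem kConfAt_eq_of_no_move (hval : kValid τ L) {i j : ℕ} (hij : i ≤ j) (hj : j ≤ L.length)
    (h : ∀ s : Fin L.length, i ≤ s → (s : ℕ) < j → (L.get s).1 ≠ a) :
    kConfAt τ L j a = kConfAt τ L i a := by
  by_contra hne
  obtain ⟨s, h1, h2, h3, -⟩ := exists_move_of_change hval a
    (fun c => c = kConfAt τ L i a) hij hj rfl hne
  exact h s h1 h2 h3

end Entries

section Gaps

variable {n : ℕ} {L : List (KMove n 3)} {τ : Fin n → Fin 3} {v : Fin n}

/-- Consecutive moves of `v` with a move of a non-cyclic vertex in between. -/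
noncomputable def gaps (L : List (KMove n 3)) (v : Fin n) :
    Finset (Fin L.length × Fin L.length) :=
  Finset.univ.filter fun p => p.1 < p.2 ∧ (L.get p.1).1 = v ∧ (L.get p.2).1 = v ∧
    (∀ s, p.1 < s → s < p.2 → (L.get s).1 ≠ v) ∧
    ∃ s, p.1 < s ∧ s < p.2 ∧ (L.get s).1 ∉ cyclicSet L

/-- Gaps containing a move of a non-cyclic vertex that makes no later move. -/
noncomputable def lastGaps (L : List (KMove n 3)) (v : Fin n) :
    Finset (Fin L.length × Fin L.length) :=
  (gaps L v).filter fun p => ∃ s, p.1 < s ∧ s < p.2 ∧ (L.get s).1 ∉ cyclicSet L ∧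
    ∀ s', p.2 < s' → (L.get s').1 ≠ (L.get s).1

/-- Gaps containing a move of a non-cyclic vertex that makes no earlier move. -/
noncomputable def firstGaps (L : List (KMove n 3)) (v : Fin n) :
    Finset (Fin L.length × Fin L.length) :=
  (gaps L v).filter fun p => ∃ s, p.1 < s ∧ s < p.2 ∧ (L.get s).1 ∉ cyclicSet L ∧
    ∀ s', s' < p.1 → (L.get s').1 ≠ (L.get s).1

/-- The part that `v` leaves at time `t` is entered again later. -/
def Returns (L : List (KMove n 3)) (v : Fin n) (t : Fin L.length) : Prop :=
  ∃ t', t < t' ∧ (L.get t').1 = v ∧ (L.get t').2.2 = (L.get t).2.1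

/-- The part that `v` enters at time `t` was left before. -/
def Revisits (L : List (KMove n 3)) (v : Fin n) (t : Fin L.length) : Prop :=
  ∃ t', t' < t ∧ (L.get t').1 = v ∧ (L.get t').2.1 = (L.get t).2.2

theorem mem_gaps {p : Fin L.length × Fin L.length} :
    p ∈ gaps L v ↔ p.1 < p.2 ∧ (L.get p.1).1 = v ∧ (L.get p.2).1 = v ∧
      (∀ s, p.1 < s → s < p.2 → (L.get s).1 ≠ v) ∧
      ∃ s, p.1 < s ∧ s < p.2 ∧ (L.get s).1 ∉ cyclicSet L := by
  simp only [gaps, Finset.mem_filter, Finset.mem_univ, true_and]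

theorem gaps_separated {p q : Fin L.length × Fin L.length} (hp : p ∈ gaps L v)
    (hq : q ∈ gaps L v) : p = q ∨ p.2 ≤ q.1 ∨ q.2 ≤ p.1 := by
  obtain ⟨p1, p2⟩ := p
  obtain ⟨q1, q2⟩ := q
  obtain ⟨h1, h2, h3, h4, -⟩ := mem_gaps.1 hp
  obtain ⟨k1, k2, k3, k4, -⟩ := mem_gaps.1 hq
  simp only at h1 h2 h3 h4 k1 k2 k3 k4
  have a1 := h4 q1
  have a2 := h4 q2
  have a3 := k4 p1
  have a4 := k4 p2
  simp only [Prod.mk.injEq]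
  grind

theorem gaps_subset (hval : kValid τ L) : gaps L v ⊆ lastGaps L v ∪ firstGaps L v := by
  intro p hp
  obtain ⟨-, -, -, -, s, hs1, hs2, hs3⟩ := mem_gaps.1 hp
  by_contra hcon
  simp only [Finset.mem_union, lastGaps, firstGaps, Finset.mem_filter, hp, true_and, not_or,
    not_exists, not_and, not_forall, not_not] at hcon
  obtain ⟨u, hu1, hu2⟩ := hcon.1 s hs1 hs2 hs3
  obtain ⟨r, hr1, hr2⟩ := hcon.2 s hs1 hs2 hs3
  have hsu : (s : ℕ) < u := hs2.trans hu1
  have hrs : (r : ℕ) < s := hr1.trans hs1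
  have N := fun (t : Fin L.length) (ht : (L.get t).1 = (L.get s).1) (i j : ℕ) hi hj hjL =>
    kConfAt_ne_of_not_cyclic hval hs3 ht (i := i) (j := j) hi hj hjL
  have e1 := N r hr2 r (r + 1) le_rfl (by omega) r.2
  have e2 := N r hr2 r (s + 1) le_rfl (by omega) s.2
  have e3 := N r hr2 r (u + 1) le_rfl (by omega) u.2
  have e4 := N s rfl (r + 1) (s + 1) hrs (by omega) s.2
  have e5 := N s rfl (r + 1) (u + 1) hrs (by omega) u.2
  have e6 := N u hu2 (s + 1) (u + 1) hsu (by omega) u.2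
  omega

theorem not_two_nonreturning (hval : kValid τ L) {t₁ t₂ u : Fin L.length} (h12 : t₁ < t₂)
    (h2u : t₂ < u) (h₁ : (L.get t₁).1 = v) (h₂ : (L.get t₂).1 = v) (hu : (L.get u).1 = v)
    (n₁ : ¬ Returns L v t₁) (n₂ : ¬ Returns L v t₂) : False := by
  have key : ∀ t s : Fin L.length, (L.get t).1 = v → (L.get s).1 = v → t < s →
      ¬ Returns L v t → (L.get s).2.1 ≠ (L.get t).2.1 ∧ (L.get s).2.2 ≠ (L.get t).2.1 := by
    intro t s ht hs hts hn
    refine ⟨fun he => hn ?_, fun he => hn ⟨s, hts, hs, he⟩⟩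
    obtain ⟨r, h1, h2, h3, h4, h5⟩ := exists_move_of_change hval v
      (fun c => c ≠ (L.get t).2.1) (i := t + 1) (j := s) hts s.2.le
      (by rw [kConfAt_move_dst hval ht]; exact (kConfAt_succ_of_valid L τ hval t).2.1.symm)
      (by rw [kConfAt_move_src hval hs, he]; simp)
    exact ⟨r, h1, h3, not_not.1 h5⟩
  have a := key t₁ t₂ h₁ h₂ h12 n₁
  have b := key t₁ u h₁ hu (h12.trans h2u) n₁
  have c := key t₂ u h₂ hu h2u n₂
  have d := (kConfAt_succ_of_valid L τ hval u).2.1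
  omega

theorem not_two_nonrevisiting (hval : kValid τ L) {u t₁ t₂ : Fin L.length} (hu1 : u < t₁)
    (h12 : t₁ < t₂) (hu : (L.get u).1 = v) (h₁ : (L.get t₁).1 = v) (h₂ : (L.get t₂).1 = v)
    (n₁ : ¬ Revisits L v t₁) (n₂ : ¬ Revisits L v t₂) : False := by
  have key : ∀ s t : Fin L.length, (L.get s).1 = v → (L.get t).1 = v → s < t →
      ¬ Revisits L v t → (L.get s).2.1 ≠ (L.get t).2.2 ∧ (L.get s).2.2 ≠ (L.get t).2.2 := by
    intro s t hs ht hst hn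
    refine ⟨fun he => hn ⟨s, hst, hs, he⟩, fun he => hn ?_⟩
    obtain ⟨r, h1, h2, h3, h4, h5⟩ := exists_move_of_change hval v
      (fun c => c = (L.get t).2.2) (i := s + 1) (j := t) hst t.2.le
      (by rw [kConfAt_move_dst hval hs, he])
      (by rw [kConfAt_move_src hval ht]; exact (kConfAt_succ_of_valid L τ hval t).2.1)
    exact ⟨r, h2, h3, h4⟩
  have a := key t₁ t₂ h₁ h₂ h12 n₂
  have b := key u t₂ hu h₂ (hu1.trans h12) n₂
  have c := key u t₁ hu h₁ hu1 n₁
  have d := (kConfAt_succ_of_valid L τ hval u).2.1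
  omega

theorem card_lastGaps_le (hval : kValid τ L) :
    (lastGaps L v).card ≤ ((lastGaps L v).filter fun p => Returns L v p.1).card + 1 := by
  rw [← Finset.card_filter_add_card_filter_not (s := lastGaps L v) (fun p => Returns L v p.1)]
  refine Nat.add_le_add_left (Finset.card_le_one.2 fun p hp q hq => ?_) _
  simp only [lastGaps, Finset.mem_filter] at hp hq
  have hp' := mem_gaps.1 hp.1.1
  have hq' := mem_gaps.1 hq.1.1
  rcases gaps_separated hp.1.1 hq.1.1 with h | h | h
  · exact h
  · exact (not_two_nonreturning hval (hp'.1.trans_le h) hq'.1 hp'.2.1 hq'.2.1 hq'.2.2.1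
      hp.2 hq.2).elim
  · exact (not_two_nonreturning hval (hq'.1.trans_le h) hp'.1 hq'.2.1 hp'.2.1 hp'.2.2.1
      hq.2 hp.2).elim

theorem card_firstGaps_le (hval : kValid τ L) :
    (firstGaps L v).card ≤ ((firstGaps L v).filter fun p => Revisits L v p.2).card + 1 := by
  rw [← Finset.card_filter_add_card_filter_not (s := firstGaps L v) (fun p => Revisits L v p.2)]
  refine Nat.add_le_add_left (Finset.card_le_one.2 fun p hp q hq => ?_) _
  simp only [firstGaps, Finset.mem_filter] at hp hq
  have hp' := mem_gaps.1 hp.1.1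
  have hq' := mem_gaps.1 hq.1.1
  rcases gaps_separated hp.1.1 hq.1.1 with h | h | h
  · exact h
  · exact (not_two_nonrevisiting hval hp'.1 (h.trans_lt hq'.1) hp'.2.1 hp'.2.2.1 hq'.2.2.1
      hp.2 hq.2).elim
  · exact (not_two_nonrevisiting hval hq'.1 (h.trans_lt hp'.1) hq'.2.1 hq'.2.2.1 hp'.2.2.1
      hq.2 hp.2).elim

end Gaps

section Blocks

variable {n : ℕ} {L : List (KMove n 3)} {v : Fin n}

theorem IsCycBlock.eq_of_mem {i j i' j' t : ℕ} (h : IsCycBlock L i j) (h' : IsCycBlock L i' j')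
    (hi : i ≤ t) (hj : t ≤ j) (hi' : i' ≤ t) (hj' : t ≤ j') : i = i' ∧ j = j' := by
  have aux : ∀ {i j i' j' : ℕ}, IsCycBlock L i j → IsCycBlock L i' j' → i ≤ t → t ≤ j →
      i' ≤ t → t ≤ j' → i' ≤ i ∧ j' ≤ j := by
    intro i j i' j' h h' hi hj hi' hj'
    constructor
    · by_contra hlt
      rcases h'.2.2.2.1 with h0 | h0
      · omega
      · exact h0 (h.2.2.1 _ (by omega) (by omega))
    · by_contra hlt
      exact h.2.2.2.2 (h'.2.2.1 _ (by omega) (by omega))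
  have a := aux h h' hi hj hi' hj'
  have b := aux h' h hi' hj' hi hj
  omega

theorem cycPos_iff (t : Fin L.length) : cycPos L t ↔ (L.get t).1 ∈ cyclicSet L := by
  simp [cycPos]

theorem bL_le_card_gaps (hv : v ∈ cyclicSet L) : bL L v ≤ (gaps L v).card + 1 := by
  unfold bL
  set B := (Finset.range L.length ×ˢ Finset.range L.length).filter
    (fun p => IsCycBlock L p.1 p.2 ∧
      ∃ t, p.1 ≤ t ∧ t ≤ p.2 ∧ ∃ m, L[t]? = some m ∧ m.1 = v)
  have memB : ∀ p ∈ B, IsCycBlock L p.1 p.2 ∧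
      ∃ t : Fin L.length, p.1 ≤ t ∧ (t : ℕ) ≤ p.2 ∧ (L.get t).1 = v := by
    intro p hp
    obtain ⟨-, h1, t, h2, h3, m, h4, h5⟩ := Finset.mem_filter.1 hp
    obtain ⟨hlt, rfl⟩ := List.getElem?_eq_some_iff.1 h4
    exact ⟨h1, ⟨t, hlt⟩, h2, h3, h5⟩
  rcases B.eq_empty_or_nonempty with h0 | ⟨p₀, hp₀⟩
  · simp [h0]
  let V : Finset (Fin L.length) := Finset.univ.filter fun t => (L.get t).1 = v
  have memV : ∀ t, t ∈ V ↔ (L.get t).1 = v := by simp [V]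
  have hVne : V.Nonempty := by
    obtain ⟨-, t, -, -, ht⟩ := memB p₀ hp₀
    exact ⟨t, (memV t).2 ht⟩
  let z := V.max' hVne
  have hz : (L.get z).1 = v := (memV z).1 (V.max'_mem hVne)
  have hsplit := Finset.card_filter_add_card_filter_not (s := B) (fun p => p.2 < (z : ℕ))
  have hlast : (B.filter fun p => ¬ p.2 < (z : ℕ)).card ≤ 1 := by
    refine Finset.card_le_one.2 fun p hp q hq => ?_
    rw [Finset.mem_filter] at hp hq
    obtain ⟨hpb, t, ht1, ht2, ht3⟩ := memB p hp.1
    obtain ⟨hqb, s, hs1, hs2, hs3⟩ := memB q hq.1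
    have htz : (t : ℕ) ≤ z := V.le_max' t ((memV t).2 ht3)
    have hsz : (s : ℕ) ≤ z := V.le_max' s ((memV s).2 hs3)
    have := hpb.eq_of_mem hqb (t := z) (by omega) (by omega) (by omega) (by omega)
    exact Prod.ext this.1 this.2
  have hgap : ∀ p ∈ B.filter fun p => p.2 < (z : ℕ), ∃ g ∈ gaps L v,
      p.1 ≤ g.1 ∧ (g.1 : ℕ) ≤ p.2 := by
    intro p hp
    rw [Finset.mem_filter] at hp
    obtain ⟨hpb, t, ht1, ht2, ht3⟩ := memB p hp.1
    let A := V.filter fun s : Fin L.length => (s : ℕ) ≤ p.2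
    let D := V.filter fun s : Fin L.length => p.2 < (s : ℕ)
    have hA : A.Nonempty := ⟨t, Finset.mem_filter.2 ⟨(memV t).2 ht3, ht2⟩⟩
    have hD : D.Nonempty := ⟨z, Finset.mem_filter.2 ⟨(memV z).2 hz, hp.2⟩⟩
    obtain ⟨ha1, ha2⟩ := Finset.mem_filter.1 (A.max'_mem hA)
    obtain ⟨hd1, hd2⟩ := Finset.mem_filter.1 (D.min'_mem hD)
    have hta : (t : ℕ) ≤ A.max' hA :=
      A.le_max' t (Finset.mem_filter.2 ⟨(memV t).2 ht3, ht2⟩)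
    have hne : (D.min' hD : ℕ) ≠ p.2 + 1 := by
      intro he
      apply hpb.2.2.2.2
      rw [← he, cycPos_iff, (memV _).1 hd1]
      exact hv
    have hlt := (D.min' hD).2
    refine ⟨(A.max' hA, D.min' hD), mem_gaps.2 ⟨Fin.lt_def.2 (by simp only; omega),
      (memV _).1 ha1, (memV _).1 hd1,
      ?_, ⟨p.2 + 1, by omega⟩, Fin.lt_def.2 (by simp only; omega),
      Fin.lt_def.2 (by simp only; omega), ?_⟩, by simp only; omega, ha2⟩
    · intro s h1 h2 hs
      by_cases h : (s : ℕ) ≤ p.2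
      · exact absurd (A.le_max' s (Finset.mem_filter.2 ⟨(memV s).2 hs, h⟩)) (not_le.2 h1)
      · exact absurd (D.min'_le s (Finset.mem_filter.2 ⟨(memV s).2 hs, by omega⟩)) (not_le.2 h2)
    · rw [← cycPos_iff]
      exact hpb.2.2.2.2
  have : Nonempty (Fin L.length × Fin L.length) := ⟨(z, z)⟩
  choose! g hg1 hg2 hg3 using hgap
  have hinj : (B.filter fun p => p.2 < (z : ℕ)).card ≤ (gaps L v).card := by
    refine Finset.card_le_card_of_injOn g hg1 fun p hp q hq hpq => ?_
    have a1 := hg2 p hp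
    have a2 := hg3 p hp
    have b1 := hg2 q hq
    have b2 := hg3 q hq
    rw [← hpq] at b1 b2
    have := (memB p (Finset.mem_filter.1 hp).1).1.eq_of_mem (memB q (Finset.mem_filter.1 hq).1).1
      a1 a2 b1 b2
    exact Prod.ext this.1 this.2
  omega

end Blocks

section Rank

variable {n : ℕ} {L : List (KMove n 3)} {τ : Fin n → Fin 3}

theorem card_le_rank_of_triangular {α β ι : Type*} [Fintype α] [Fintype β] [Fintype ι]
    (M : Matrix α β ℚ) (r : ι → α) (c : ι → β) (key : ι → ℤ)
    (hdiag : ∀ i, M (r i) (c i) ≠ 0)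
    (htri : ∀ i j, M (r i) (c j) ≠ 0 → j = i ∨ key j < key i) :
    Fintype.card ι ≤ M.rank := by
  have hli : LinearIndependent ℚ fun i => M.col (c i) := by
    rw [Fintype.linearIndependent_iff]
    intro g hg
    by_contra! hne
    obtain ⟨i₀, hi₀⟩ := hne
    obtain ⟨i, hi, hmin⟩ := Finset.exists_min_image (Finset.univ.filter fun i => g i ≠ 0) key
      ⟨i₀, by simpa using hi₀⟩
    simp only [Finset.mem_filter, Finset.mem_univ, true_and] at hi hmin
    have h := congrFun hg (r i)
    rw [Finset.sum_apply, Finset.sum_eq_single i] at h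
    · exact mul_ne_zero hi (hdiag i) h
    · intro j _ hji
      by_contra hnz
      obtain ⟨hgj, hM⟩ := mul_ne_zero_iff.1 hnz
      rcases htri i j hM with h1 | h1
      · exact hji h1
      · exact absurd (hmin j hgj) (not_le.2 h1)
    · simp
  rw [Matrix.rank_eq_finrank_span_cols, ← finrank_span_eq_card hli]
  exact Submodule.finrank_mono (Submodule.span_mono (by rintro _ ⟨i, rfl⟩; exact ⟨c i, rfl⟩))

/-- Rows of non-cyclic vertices and columns of cycles over `v` forming a triangular
submatrix with nonzero diagonal. -/
def HasTriangularFamily (L : List (KMove n 3)) (τ : Fin n → Fin 3) (v : Fin n) (m : ℕ) : Prop :=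
  ∃ (a : Fin m → Fin n) (C : Fin m → Finset (Fin L.length)) (key : Fin m → ℤ),
    (∀ i, a i ∉ cyclicSet L) ∧ (∀ i, IsCycle L v (C i)) ∧
    (∀ i, kPval L τ (a i) v (C i) ≠ 0) ∧
    ∀ i j, kPval L τ (a i) v (C j) ≠ 0 → j = i ∨ key j < key i

theorem hasTriangularFamily_of_finset {γ : Type*} {v : Fin n} (S : Finset γ) (key : γ → ℤ)
    (R : γ → Fin n → Finset (Fin L.length) → Prop)
    (hex : ∀ p ∈ S, ∃ a T, a ∉ cyclicSet L ∧ IsCycle L v T ∧ kPval L τ a v T ≠ 0 ∧ R p a T)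
    (htri : ∀ p ∈ S, ∀ q ∈ S, ∀ a T b U, a ∉ cyclicSet L → IsCycle L v U → R p a T → R q b U →
      kPval L τ a v U ≠ 0 → q = p ∨ key q < key p) :
    HasTriangularFamily L τ v S.card := by
  choose a T h1 h2 h3 h4 using hex
  let e := S.equivFin.symm
  refine ⟨fun i => a (e i) (e i).2, fun i => T (e i) (e i).2, fun i => key (e i), fun i => h1 _ (e i).2,
    fun i => h2 _ (e i).2, fun i => h3 _ (e i).2, fun i j hij => ?_⟩
  rcases htri _ (e i).2 _ (e j).2 _ _ _ _ (h1 _ (e i).2) (h2 _ (e j).2) (h4 _ (e i).2)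
    (h4 _ (e j).2) hij with h | h
  · exact Or.inl (e.injective (Subtype.ext h))
  · exact Or.inr h

theorem hasTriangularFamily_lastGaps (hval : kValid τ L) {v : Fin n} (hv : v ∈ cyclicSet L) :
    HasTriangularFamily L τ v ((lastGaps L v).filter fun p => Returns L v p.1).card := by
  have hconst : ∀ {a : Fin n} {u t : Fin L.length}, (∀ s, u < s → (L.get s).1 ≠ a) → u ≤ t →
      kConfAt τ L (t + 1) a = kConfAt τ L (u + 1) a := fun {a u t} h hut =>
    kConfAt_eq_of_no_move hval (Nat.succ_le_succ hut) t.2 fun s hs _ => h s hs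
  refine hasTriangularFamily_of_finset _ (fun p => ((p.1 : ℕ) : ℤ))
    (fun p a T => (∀ s, p.2 < s → (L.get s).1 ≠ a) ∧ ∀ s ∈ T, p.1 ≤ s) ?_ ?_
  · intro p hp
    simp only [lastGaps, Finset.mem_filter] at hp
    obtain ⟨⟨hg, s, hs1, hs2, hs3, hs4⟩, t', ht1, ht2, ht3⟩ := hp
    obtain ⟨g1, g2, g3, g4, -⟩ := mem_gaps.1 hg
    obtain ⟨T, hT, hpT, hTt⟩ := exists_cycle_of_return hval ht1 g2 ht2 ht3
    have hav : (L.get s).1 ≠ v := g4 s hs1 hs2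
    refine ⟨(L.get s).1, T, hs3, hT, ?_, hs4, fun r hr => ?_⟩
    · refine kPval_ne_zero_of_const_off hval hav hT.1 hpT (c := kConfAt τ L (p.2 + 1) (L.get s).1)
        (fun t ht htp => hconst hs4 ?_) ?_
      · exact not_lt.1 fun hlt => g4 t (hTt t ht htp) hlt (hT.1.2.1 t ht)
      · exact kConfAt_ne_of_not_cyclic hval hs3 rfl hs1 (Nat.lt_succ_of_lt hs2) p.2.2
    · by_cases h : r = p.1
      · exact h.ge
      · exact (hTt r hr h).le
  · intro p hp q hq a T b U ha hU hpa hqb hne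
    simp only [lastGaps, Finset.mem_filter] at hp hq
    rcases gaps_separated hp.1.1 hq.1.1 with h | h | h
    · exact Or.inl h.symm
    · refine absurd (kPval_eq_zero_of_const hval (fun hav : a = v => ha (hav ▸ hv)) hU.1
        fun t ht => hconst hpa.1 (h.trans (hqb.2 t ht))) hne
    · have := (mem_gaps.1 hq.1.1).1.trans_le h
      exact Or.inr (by exact_mod_cast this)

theorem hasTriangularFamily_firstGaps (hval : kValid τ L) {v : Fin n} (hv : v ∈ cyclicSet L) :
    HasTriangularFamily L τ v ((firstGaps L v).filter fun p => Revisits L v p.2).card := by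
  have hconst : ∀ {a : Fin n} {u t : Fin L.length}, (∀ s, s < u → (L.get s).1 ≠ a) →
      (L.get u).1 ≠ a → t ≤ u →
      kConfAt τ L (t + 1) a = kConfAt τ L (u + 1) a := fun {a u t} h hu htu =>
    (kConfAt_eq_of_no_move hval (Nat.succ_le_succ htu) u.2 fun s _ hs => by
      rcases (Nat.lt_succ_iff.1 hs).lt_or_eq with h' | h'
      · exact h s h'
      · rwa [Fin.ext h']).symm
  refine hasTriangularFamily_of_finset _ (fun p => -((p.2 : ℕ) : ℤ))
    (fun p a T => (∀ s, s < p.1 → (L.get s).1 ≠ a) ∧ ∀ s ∈ T, s ≤ p.2) ?_ ?_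
  · intro p hp
    simp only [firstGaps, Finset.mem_filter] at hp
    obtain ⟨⟨hg, s, hs1, hs2, hs3, hs4⟩, t', ht1, ht2, ht3⟩ := hp
    obtain ⟨g1, g2, g3, g4, -⟩ := mem_gaps.1 hg
    obtain ⟨T, hT, hpT, hTt⟩ := exists_cycle_of_previous_visit hval ht1 g3 ht2 ht3
    have hav : (L.get s).1 ≠ v := g4 s hs1 hs2
    refine ⟨(L.get s).1, T, hs3, hT, ?_, hs4, fun r hr => ?_⟩
    · refine kPval_ne_zero_of_const_off hval hav hT.1 hpT (c := kConfAt τ L (p.1 + 1) (L.get s).1)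
        (fun t ht htp => hconst hs4 (g2 ▸ hav.symm) ?_) ?_
      · exact not_lt.1 fun hlt => g4 t hlt (hTt t ht htp) (hT.1.2.1 t ht)
      · exact (kConfAt_ne_of_not_cyclic hval hs3 rfl hs1 (Nat.lt_succ_of_lt hs2) p.2.2).symm
    · by_cases h : r = p.2
      · exact h.le
      · exact (hTt r hr h).le
  · intro p hp q hq a T b U ha hU hpa hqb hne
    simp only [firstGaps, Finset.mem_filter] at hp hq
    have hav : a ≠ v := fun hav : a = v => ha (hav ▸ hv)
    rcases gaps_separated hp.1.1 hq.1.1 with h | h | h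
    · exact Or.inl h.symm
    · have := h.trans_lt (mem_gaps.1 hq.1.1).1
      exact Or.inr (by simpa using this)
    · refine absurd (kPval_eq_zero_of_const hval hav hU.1
        fun t ht => hconst hpa.1 ((mem_gaps.1 hp.1.1).2.1 ▸ hav.symm) ((hqb.2 t ht).trans h)) hne

theorem exists_hasTriangularFamily (hval : kValid τ L) {v : Fin n} (hv : v ∈ cyclicSet L) :
    ∃ m, bL L v ≤ 2 * m + 3 ∧ HasTriangularFamily L τ v m := by
  have h1 := bL_le_card_gaps hv
  have h2 := (Finset.card_le_card (gaps_subset (v := v) hval)).trans (Finset.card_union_le _ _)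
  have h3 := card_lastGaps_le (v := v) hval
  have h4 := card_firstGaps_le (v := v) hval
  rcases le_total (firstGaps L v).card (lastGaps L v).card with h | h
  · exact ⟨_, by omega, hasTriangularFamily_lastGaps hval hv⟩
  · exact ⟨_, by omega, hasTriangularFamily_firstGaps hval hv⟩

/-- The edge joining two distinct vertices. -/
def edgeOf {a b : Fin n} (h : a ≠ b) : mcEdge n :=
  if hlt : a < b then ⟨(a, b), hlt⟩ else ⟨(b, a), lt_of_le_of_ne (not_lt.1 hlt) h.symm⟩

theorem kP_edgeOf {a b : Fin n} (h : a ≠ b) (c : KCycle L) :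
    kP L τ (edgeOf h) c = kPval L τ a b c.1.2 := by
  unfold kP edgeOf
  split_ifs
  · rfl
  · exact kPval_comm L τ b a c.1.2

theorem kPval_eq_zero_of_ne {a v w : Fin n} (hav : a ≠ w) (hvw : v ≠ w)
    {T : Finset (Fin L.length)} (hT : IsCircuit L w T) : kPval L τ a v T = 0 :=
  Finset.sum_eq_zero fun t ht =>
    kM_eq_zero (by rw [hT.2.1 t ht]; exact hav) (by rw [hT.2.1 t ht]; exact hvw)

end Rank

/-- improved rank lower bound, max-3-cut on the complete graph.
For every sequence `L` valid from `τ0`,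
`rank(P_{L,τ0}) ≥ (1/6)·∑_{v ∈ C(L)} (b_L(v) − 3)`. -/
theorem rank_ge_cyclicBlocks_k3 {n : ℕ}
    (L : List (KMove n 3)) (τ0 : Fin n → Fin 3) (hvalid : kValid τ0 L) :
    (1 / 6 : ℝ) * ∑ v ∈ cyclicSet L, ((bL L v : ℝ) - 3) ≤ (((kP L τ0).rank : ℝ)) := by
  have hfam := fun v : {v // v ∈ cyclicSet L} => exists_hasTriangularFamily hvalid v.2
  choose m hm a C key ha hC hdiag htri using hfam
  have hav : ∀ v i, a v i ≠ v.1 := fun v i h => ha v i (h ▸ v.2)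
  have hrank : Fintype.card (Σ v, Fin (m v)) ≤ (kP L τ0).rank := by
    refine card_le_rank_of_triangular (kP L τ0) (fun x => edgeOf (hav x.1 x.2))
      (fun x => ⟨(x.1.1, C x.1 x.2), hC x.1 x.2⟩) (fun x => key x.1 x.2) (fun x => ?_) ?_
    · rw [kP_edgeOf]
      exact hdiag x.1 x.2
    · rintro ⟨v, i⟩ ⟨w, j⟩ hne
      rw [kP_edgeOf] at hne
      by_cases hvw : v = w
      · subst hvw
        rcases htri v i j hne with h | h
        · exact Or.inl (by rw [h])
        · exact Or.inr h
      · exact absurd (kPval_eq_zero_of_ne (fun h : a v i = w => ha v i (h ▸ w.2))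
          (fun h => hvw (Subtype.ext h)) (hC w j).1) hne
  rw [Fintype.card_sigma] at hrank
  simp only [Fintype.card_fin] at hrank
  have hrank' : (∑ v, (m v : ℝ)) ≤ ((kP L τ0).rank : ℝ) := by exact_mod_cast hrank
  refine le_trans ?_ hrank'
  rw [← Finset.sum_coe_sort, Finset.mul_sum]
  refine Finset.sum_le_sum fun v _ => ?_
  have h : ((bL L v : ℕ) : ℝ) ≤ 2 * m v + 3 := by exact_mod_cast hm v
  have h0 : (0 : ℝ) ≤ m v := Nat.cast_nonneg _
  linarith
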